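/- arXiv:2105.12534 — 2 statements merged into one kernel-verified Lean document; each statement's English description precedes it below -/
import Mathlib

section
/- Let R be a dark minimal equivalence relation. Then the R-equivalence classes are pairwise computably inseparable: there is no decidable set C ⊆ ℕ and x, y ∈ ℕ with ¬(R x y) such that {z : R z x} ⊆ C and {z : R z y} ∩ C = ∅. -/
/-- A computable reduction of `R` to `S`: a total computable function `f` with
`R x y ↔ S (f x) (f y)`.  `CompRed R S` means such a reduction exists (`R ≤c S`). -/
def CompRed (R S : ℕ → ℕ → Prop) : Prop :=
  ∃ f : ℕ → ℕ, Computable f ∧ ∀ x y, R x y ↔ S (f x) (f y)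

/-- `R ≡c S`. -/
def EquivC (R S : ℕ → ℕ → Prop) : Prop := CompRed R S ∧ CompRed S R

/-- `R <c S`. -/
def StrictRed (R S : ℕ → ℕ → Prop) : Prop := CompRed R S ∧ ¬ CompRed S R

/-- The identity equivalence relation `Id` on ℕ. -/
def IdEq : ℕ → ℕ → Prop := fun x y => x = y

/-- `Id_n` : congruence modulo `n` on ℕ. -/
def IdN (n : ℕ) : ℕ → ℕ → Prop := fun x y => x % n = y % n

/-- The uniform join `R ⊕ S`. -/
def Join (R S : ℕ → ℕ → Prop) : ℕ → ℕ → Prop := fun a b =>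
  (∃ x y, a = 2 * x ∧ b = 2 * y ∧ R x y) ∨
  (∃ x y, a = 2 * x + 1 ∧ b = 2 * y + 1 ∧ S x y)

/-- The set of equivalence classes of `R`. -/
def classes (R : ℕ → ℕ → Prop) : Set (Set ℕ) := {C | ∃ a, C = {z | R z a}}

/-- `R` is dark: infinitely many classes and `Id` does not reduce to `R`. -/
def Dark (R : ℕ → ℕ → Prop) : Prop := (classes R).Infinite ∧ ¬ CompRed IdEq R

/-- `R` is dark minimal: dark, and everything strictly below has finitely many classes. -/
def DarkMinimal (R : ℕ → ℕ → Prop) : Prop :=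
  Dark R ∧ ∀ S : ℕ → ℕ → Prop, Equivalence S → StrictRed S R → (classes S).Finite

/-- `T` is a least upper bound of `R` and `S` in the computable-reducibility order. -/
def IsLub' (R S T : ℕ → ℕ → Prop) : Prop :=
  CompRed R T ∧ CompRed S T ∧
    ∀ U : ℕ → ℕ → Prop, Equivalence U → CompRed R U → CompRed S U → CompRed T U

/-- `W` is computably enumerable. -/
def CE (W : Set ℕ) : Prop := W = ∅ ∨ ∃ f : ℕ → ℕ, Computable f ∧ W = Set.range f

/-- `R ≤_F S`: `R` restricted to a decidable set `A` computably reduces to `S`,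
and `R` restricted to the complement of `A` has finitely many classes. -/
def FRed (R S : ℕ → ℕ → Prop) : Prop :=
  ∃ A : Set ℕ, ComputablePred (· ∈ A) ∧
    (∃ f : ℕ → ℕ, Computable f ∧ ∀ x ∈ A, ∀ y ∈ A, (R x y ↔ S (f x) (f y))) ∧
    {C : Set ℕ | ∃ a ∉ A, C = {z | z ∉ A ∧ R z a}}.Finite

/-- `U` is a pure quotient of `R ⊕ S`. -/
def PureQuotient (R S U : ℕ → ℕ → Prop) : Prop :=
  (∀ a b, Join R S a b → U a b) ∧
  (∀ x y, U (2 * x) (2 * y) ↔ R x y) ∧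
  (∀ x y, U (2 * x + 1) (2 * y + 1) ↔ S x y)

/-- `R` is noncomputably avoiding: for every finite set of representatives of
noncomputable `R`-classes, some self-reduction of `R` avoids all those classes. -/
def NCA (R : ℕ → ℕ → Prop) : Prop :=
  ∀ F : Finset ℕ, (∀ a ∈ F, ¬ ComputablePred fun z => R z a) →
    ∃ g : ℕ → ℕ, Computable g ∧ (∀ x y, R x y ↔ R (g x) (g y)) ∧
      ∀ a ∈ F, ∀ x, ¬ R (g x) a

/-- `R` is self-full: every computable self-reduction of `R` hits every `R`-class. -/
def SelfFull (R : ℕ → ℕ → Prop) : Prop :=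
  ∀ f : ℕ → ℕ, Computable f → (∀ x y, R x y ↔ R (f x) (f y)) → ∀ y, ∃ x, R (f x) y

/-- `T` is a strong minimal cover of `R`. -/
def StrongMinCover (R T : ℕ → ℕ → Prop) : Prop :=
  StrictRed R T ∧ ∀ X : ℕ → ℕ → Prop, Equivalence X → StrictRed X T → CompRed X R

theorem Computable.iterate_apply {f : ℕ → ℕ} (hf : Computable f) (y : ℕ) :
    Computable fun n => f^[n] y := by
  have h : Computable fun n : ℕ => (Nat.rec y (fun _ r => f r) n : ℕ) :=
    Computable.nat_rec Computable.id (Computable.const y)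
      (hf.comp (Computable.snd.comp Computable.snd)).to₂
  refine h.of_eq fun n => ?_
  induction n with
  | zero => rfl
  | succ n ih => rw [Function.iterate_succ_apply', ← ih]

/-- A computable self-reduction of `R` whose range misses a class yields `Id ≤c R`. -/
theorem compRed_idEq_of_selfReduction_avoids {R : ℕ → ℕ → Prop} (hR : Equivalence R)
    {f : ℕ → ℕ} (hf : Computable f) (hred : ∀ x y, R x y ↔ R (f x) (f y)) {y : ℕ}
    (hy : ∀ x, ¬ R (f x) y) : CompRed IdEq R := by
  have hiter : ∀ n a b, R a b ↔ R (f^[n] a) (f^[n] b) := by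
    intro n
    induction n with
    | zero => exact fun a b => Iff.rfl
    | succ n ih =>
      intro a b
      rw [Function.iterate_succ_apply', Function.iterate_succ_apply', ← hred]
      exact ih a b
  have hlt : ∀ i j, i < j → ¬ R (f^[i] y) (f^[j] y) := by
    intro i j hij h
    obtain ⟨k, rfl⟩ := Nat.exists_eq_add_of_lt hij
    rw [add_assoc, Function.iterate_add_apply, ← hiter, Function.iterate_succ_apply'] at h
    exact hy _ (hR.symm h)
  refine ⟨fun n => f^[n] y, hf.iterate_apply y, fun i j => ⟨?_, fun h => ?_⟩⟩
  · rintro rfl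
    exact hR.refl _
  · by_contra hne
    rcases lt_or_gt_of_ne hne with hij | hij
    · exact hlt i j hij h
    · exact hlt j i hij (hR.symm h)

/-- A decidable set meeting infinitely many classes of a dark minimal relation
meets all of its classes. -/
theorem DarkMinimal.exists_mem_rel {R : ℕ → ℕ → Prop} (hR : Equivalence R)
    (hmin : DarkMinimal R) {C : Set ℕ} (hC : ComputablePred (· ∈ C))
    (hinf : {K : Set ℕ | ∃ a ∈ C, K = {z | R z a}}.Infinite) (y : ℕ) :
    ∃ z ∈ C, R z y := by
  by_contra! hy
  obtain ⟨_, c, hc, -⟩ := hinf.nonempty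
  obtain ⟨_, hdec⟩ := hC
  let h : ℕ → ℕ := fun n => bif decide (n ∈ C) then n else c
  have hh : Computable h := Computable.cond hdec Computable.id (Computable.const c)
  have hmem : ∀ n, h n ∈ C := by
    intro n
    by_cases hn : n ∈ C <;> simp [h, hn, hc]
  have hfix : ∀ n ∈ C, h n = n := fun n hn => by simp [h, hn]
  let S : ℕ → ℕ → Prop := fun a b => R (h a) (h b)
  have hS : Equivalence S := ⟨fun _ => hR.refl _, fun h => hR.symm h, fun h k => hR.trans h k⟩
  have hSinf : ¬ (classes S).Finite := by
    intro hfin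
    refine hinf ((hfin.image fun K => {z | ∃ w ∈ K, R z (h w)}).subset ?_)
    rintro _ ⟨a, ha, rfl⟩
    refine ⟨{z | S z a}, ⟨a, rfl⟩, ?_⟩
    ext z
    constructor
    · rintro ⟨w, hw, hz⟩
      have hza := hR.trans hz hw
      rwa [hfix a ha] at hza
    · intro hz
      exact ⟨a, hS.refl a, by rwa [hfix a ha]⟩
  have hRS : CompRed R S := by
    by_contra hn
    exact hSinf (hmin.2 S hS ⟨⟨h, hh, fun _ _ => Iff.rfl⟩, hn⟩)
  obtain ⟨g, hg, hred⟩ := hRS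
  exact hmin.1.2 (compRed_idEq_of_selfReduction_avoids hR (hh.comp hg) hred
    fun x => hy _ (hmem (g x)))

theorem stmt_5 (R : ℕ → ℕ → Prop) (hR : Equivalence R) (hmin : DarkMinimal R) :
    ¬ ∃ (C : Set ℕ) (x y : ℕ), ComputablePred (· ∈ C) ∧ ¬ R x y ∧
      {z | R z x} ⊆ C ∧ {z | R z y} ∩ C = ∅ := by
  rintro ⟨C, x, y, hC, -, hx, hy⟩
  by_cases hfin : {K : Set ℕ | ∃ a ∈ C, K = {z | R z a}}.Finite
  · have hinf : {K : Set ℕ | ∃ a ∈ Cᶜ, K = {z | R z a}}.Infinite := by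
      intro hfin'
      refine hmin.1.1 ((hfin.union hfin').subset ?_)
      rintro _ ⟨a, rfl⟩
      by_cases ha : a ∈ C
      · exact Or.inl ⟨a, ha, rfl⟩
      · exact Or.inr ⟨a, ha, rfl⟩
    obtain ⟨z, hz, hzx⟩ := hmin.exists_mem_rel hR hC.not hinf x
    exact hz (hx hzx)
  · obtain ⟨z, hz, hzy⟩ := hmin.exists_mem_rel hR hC hfin y
    exact Set.eq_empty_iff_forall_notMem.1 hy z ⟨hzy, hz⟩
end

section
/- An equivalence relation E on ℕ has a least upper bound with every equivalence relation on ℕ if and only if E ≡c Id_n for some n ≥ 1. -/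
/-- The colouring of `ℕ` that is `a` on the even numbers and `b ∘ c` on the odd ones. -/
def joinColor (a b c : ℕ → ℕ) (n : ℕ) : ℕ :=
  if n % 2 = 0 then a (n / 2) else b (c (n / 2))

theorem joinColor_even (a b c : ℕ → ℕ) (x : ℕ) : joinColor a b c (2 * x) = a x := by
  simp [joinColor]

theorem joinColor_odd (a b c : ℕ → ℕ) (x : ℕ) : joinColor a b c (2 * x + 1) = b (c x) := by
  have h : (2 * x + 1) / 2 = x := by omega
  simp [joinColor, h]

theorem CompRed.trans {R S T : ℕ → ℕ → Prop} (h₁ : CompRed R S) (h₂ : CompRed S T) :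
    CompRed R T := by
  obtain ⟨f, hf, hfr⟩ := h₁
  obtain ⟨g, hg, hgr⟩ := h₂
  exact ⟨fun x => g (f x), hg.comp hf, fun x y => (hfr x y).trans (hgr _ _)⟩

theorem equivalence_color (u : ℕ → ℕ) : Equivalence fun x y => u x = u y :=
  ⟨fun _ => rfl, Eq.symm, Eq.trans⟩

theorem Equivalence.exists_color {E : ℕ → ℕ → Prop} (hE : Equivalence E) :
    ∃ e : ℕ → ℕ, ∀ x y, E x y ↔ e x = e y := by
  let s : Setoid ℕ := ⟨E, hE⟩
  exact ⟨fun x => (Quotient.mk s x).out, fun x y =>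
    (Quotient.eq (r := s)).symm.trans Quotient.out_inj.symm⟩

theorem countable_computable : {f : ℕ → ℕ | Computable f}.Countable := by
  have h : (Set.range Nat.Partrec.Code.eval).Countable := Set.countable_range _
  refine Set.Countable.mono ?_ (h.preimage (f := fun f : ℕ → ℕ => (f : ℕ →. ℕ)) ?_)
  · intro f hf
    exact Nat.Partrec.Code.exists_code.1 (Partrec.nat_iff.1 hf)
  · intro f g hfg
    funext x
    exact Part.some_inj.1 (congrFun hfg x)

/-- A function of a bounded computable quantity is computable. -/
theorem Computable.comp_of_bounded {f : ℕ → ℕ} (hf : Computable f) {B : ℕ}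
    (hB : ∀ x, f x < B) (t : ℕ → ℕ) : Computable fun x => t (f x) := by
  have h : Computable fun x => ((List.range B).map t).getD (f x) 0 :=
    (Primrec.list_getD 0).to_comp.comp (Computable.const _) hf
  refine h.of_eq fun x => ?_
  simp [List.getD, hB x]

theorem compRed_idN {R : ℕ → ℕ → Prop} (hR : Equivalence R) {n : ℕ} (hn : 1 ≤ n) (r : ℕ → ℕ)
    (hr : ∀ a < n, ∀ b < n, R (r a) (r b) → a = b) : CompRed (IdN n) R := by
  have hlt : ∀ x, x % n < n := fun x => Nat.mod_lt _ hn
  refine ⟨fun x => r (x % n), Computable.comp_of_bounded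
    (Primrec.nat_mod.to_comp.comp Computable.id (Computable.const n)) hlt r, fun x y => ?_⟩
  refine ⟨fun h => ?_, hr _ (hlt x) _ (hlt y)⟩
  simp only [IdN] at h
  beta_reduce
  rw [h]
  exact hR.refl _

/-- A relation pulled back along a computable function of finite range is equivalent to some
`IdN n`. -/
theorem exists_equivC_idN {E : ℕ → ℕ → Prop} (hE : Equivalence E) {f : ℕ → ℕ}
    (hf : Computable f) (hfin : (Set.range f).Finite) {c : ℕ → ℕ}
    (hc : ∀ x y, E x y ↔ c (f x) = c (f y)) : ∃ n : ℕ, 1 ≤ n ∧ EquivC E (IdN n) := by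
  obtain ⟨B, hB⟩ := hfin.bddAbove
  have hfB : ∀ x, f x < B + 1 := fun x => Nat.lt_succ_of_le (hB ⟨x, rfl⟩)
  have hCfin : (Set.range fun x => c (f x)).Finite :=
    (hfin.image c).subset (by rintro _ ⟨x, rfl⟩; exact ⟨f x, ⟨x, rfl⟩, rfl⟩)
  have : Finite (Set.range fun x => c (f x)) := hCfin
  obtain ⟨n, ⟨φ⟩⟩ := Finite.exists_equiv_fin (Set.range fun x => c (f x))
  have hn : 1 ≤ n := (Nat.zero_le _).trans_lt (φ ⟨_, 0, rfl⟩).isLt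
  classical
  let t : ℕ → ℕ := fun v =>
    if h : c v ∈ Set.range fun x => c (f x) then (φ ⟨c v, h⟩ : ℕ) else 0
  have ht : ∀ x, t (f x) = φ ⟨c (f x), Set.mem_range_self x⟩ := fun x => dif_pos _
  refine ⟨n, hn, ⟨fun x => t (f x), hf.comp_of_bounded hfB t, fun x y => ?_⟩, ?_⟩
  · beta_reduce
    rw [hc, IdN, ht, ht, Nat.mod_eq_of_lt (Fin.isLt _), Nat.mod_eq_of_lt (Fin.isLt _),
      ← Fin.ext_iff, φ.apply_eq_iff_eq, Subtype.mk_eq_mk]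
  · choose g hg using fun i : Fin n => (φ.symm i).2
    refine compRed_idN hE hn (fun a => if h : a < n then g ⟨a, h⟩ else 0) ?_
    intro a ha b hb h
    simp only [ha, hb, dif_pos, hc] at h
    have h' : φ.symm ⟨a, ha⟩ = φ.symm ⟨b, hb⟩ :=
      Subtype.ext ((hg _).symm.trans (h.trans (hg _)))
    simpa using φ.symm.injective h'

section Generic

theorem dense_of_finset {s : Set (ℕ → ℕ)}
    (h : ∀ (c₀ : ℕ → ℕ) (F : Finset ℕ), ∃ c ∈ s, ∀ i ∈ F, c i = c₀ i) : Dense s := by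
  intro c₀
  rw [mem_closure_iff]
  intro o ho hc₀
  obtain ⟨F, v, hv, hsub⟩ := isOpen_pi_iff.1 ho c₀ hc₀
  obtain ⟨c, hcs, hc⟩ := h c₀ F
  exact ⟨c, hsub fun i hi => by rw [hc i hi]; exact (hv i hi).2, hcs⟩

theorem continuous_joinColor (a b : ℕ → ℕ) (n : ℕ) :
    Continuous fun c : ℕ → ℕ => joinColor a b c n := by
  unfold joinColor
  split_ifs
  · exact continuous_const
  · exact continuous_of_discreteTopology.comp (continuous_apply _)

theorem isOpen_not_reduction {u v : (ℕ → ℕ) → ℕ → ℕ} (hu : ∀ n, Continuous fun c => u c n)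
    (hv : ∀ n, Continuous fun c => v c n) (g : ℕ → ℕ) :
    IsOpen {c | ¬ ∀ x y, u c x = u c y ↔ v c (g x) = v c (g y)} := by
  simp only [not_forall, Set.ofPred_exists]
  refine isOpen_iUnion fun x => isOpen_iUnion fun y => ?_
  exact (isOpen_discrete {p : (ℕ × ℕ) × (ℕ × ℕ) | ¬ (p.1.1 = p.1.2 ↔ p.2.1 = p.2.2)}).preimage
    (((hu x).prodMk (hu y)).prodMk ((hv (g x)).prodMk (hv (g y))))

/-- The colouring extending `c₀` on `F` by the indicator function of `{z}`. -/
def extendColor (c₀ : ℕ → ℕ) (F : Finset ℕ) (z n : ℕ) : ℕ :=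
  if n ∈ F then c₀ n else if n = z then 1 else 0

variable {c₀ : ℕ → ℕ} {F : Finset ℕ}

theorem extendColor_mem (z : ℕ) {n : ℕ} (hn : n ∈ F) : extendColor c₀ F z n = c₀ n := by
  simp [extendColor, hn]

theorem extendColor_self {z : ℕ} (hz : z ∉ F) : extendColor c₀ F z z = 1 := by
  simp [extendColor, hz]

theorem extendColor_ne {z n : ℕ} (hn : n ∉ F) (h : n ≠ z) : extendColor c₀ F z n = 0 := by
  simp [extendColor, hn, h]

theorem dense_not_reduction_join {a b : ℕ → ℕ} (hb : b.Injective) {g : ℕ → ℕ}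
    (hg : {x | g x ≠ 2 * x + 1}.Infinite) :
    Dense {c : ℕ → ℕ | ¬ ∀ x y, c x = c y ↔ joinColor a b c (g x) = joinColor a b c (g y)} := by
  refine dense_of_finset fun c₀ F => ?_
  by_contra hcon
  replace hcon : ∀ z x y, extendColor c₀ F z x = extendColor c₀ F z y ↔
      joinColor a b (extendColor c₀ F z) (g x) = joinColor a b (extendColor c₀ F z) (g y) := by
    intro z
    by_contra h
    exact hcon ⟨_, h, fun i hi => extendColor_mem z hi⟩
  let bound : Set ℕ := {x | g x % 2 = 0 ∨ g x / 2 ∈ F}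
  have hbound : ∀ x ∈ bound, ∀ z w,
      joinColor a b (extendColor c₀ F z) (g x) = joinColor a b (extendColor c₀ F w) (g x) := by
    rintro x (hx | hx) z w
    · simp [joinColor, hx]
    · simp [joinColor, extendColor_mem, hx]
  have hbfin : bound.Finite := by
    by_contra hinf
    obtain ⟨x, hx, hxF⟩ := Set.Infinite.exists_notMem_finset hinf F
    obtain ⟨y, hy, hyF⟩ := Set.Infinite.exists_notMem_finset hinf (insert x F)
    simp only [Finset.mem_insert, not_or] at hyF
    obtain ⟨z, hz⟩ := Infinite.exists_notMem_finset (insert x (insert y F))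
    simp only [Finset.mem_insert, not_or] at hz
    have h₁ := (hcon z x y).1 (by
      rw [extendColor_ne hxF (Ne.symm hz.1), extendColor_ne hyF.2 (Ne.symm hz.2.1)])
    rw [hbound x hx z y, hbound y hy z y, ← hcon, extendColor_self hyF.2,
      extendColor_ne hxF (Ne.symm hyF.1)] at h₁
    exact zero_ne_one h₁
  have hfree := hg.sdiff hbfin
  have hodd : ∀ z x, x ∉ bound →
      joinColor a b (extendColor c₀ F z) (g x) = b (extendColor c₀ F z (g x / 2)) := by
    intro z x hx
    simp only [bound, Set.mem_ofPred_eq, not_or] at hx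
    simp [joinColor, hx.1]
  obtain ⟨x, ⟨hx, hxb⟩, hxF⟩ := hfree.exists_notMem_finset F
  obtain ⟨y, ⟨hy, hyb⟩, hyF⟩ := hfree.exists_notMem_finset (insert x (insert (g x / 2) F))
  simp only [Finset.mem_insert, not_or] at hyF
  obtain ⟨hyx, hyz, hyF⟩ := hyF
  have hxb' := hxb
  have hyb' := hyb
  simp only [bound, Set.mem_ofPred_eq, not_or] at hxb' hyb' hx hy
  by_cases hzw : g x / 2 = g y / 2
  · have h := (hcon y x y).2 (by rw [hodd _ _ hxb, hodd _ _ hyb, hzw])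
    rw [extendColor_self hyF, extendColor_ne hxF (Ne.symm hyx)] at h
    exact zero_ne_one h
  · have h := (hcon (g x / 2) x y).1 (by
      rw [extendColor_ne hxF (by omega), extendColor_ne hyF hyz])
    rw [hodd _ _ hxb, hodd _ _ hyb, hb.eq_iff, extendColor_self hxb'.2,
      extendColor_ne hyb'.2 (Ne.symm hzw)] at h
    exact one_ne_zero h

theorem dense_not_reduction {e f : ℕ → ℕ} (hf : (Set.range f).Infinite) :
    Dense {c : ℕ → ℕ | ¬ ∀ x y, e x = e y ↔ c (f x) = c (f y)} := by
  refine dense_of_finset fun c₀ F => ?_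
  by_contra hcon
  replace hcon : ∀ z x y, e x = e y ↔
      extendColor c₀ F z (f x) = extendColor c₀ F z (f y) := by
    intro z
    by_contra h
    exact hcon ⟨_, h, fun i hi => extendColor_mem z hi⟩
  obtain ⟨_, ⟨x, rfl⟩, hxF⟩ := hf.exists_notMem_finset F
  obtain ⟨_, ⟨y, rfl⟩, hyF⟩ := hf.exists_notMem_finset (insert (f x) F)
  obtain ⟨z, hz⟩ := Infinite.exists_notMem_finset (insert (f x) (insert (f y) F))
  simp only [Finset.mem_insert, not_or] at hz hyF
  have h := (hcon z x y).2 (by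
    rw [extendColor_ne hxF (Ne.symm hz.1), extendColor_ne hyF.2 (Ne.symm hz.2.1)])
  rw [hcon (f x), extendColor_self hxF, extendColor_ne hyF.2 hyF.1] at h
  exact one_ne_zero h

theorem isOpen_exists_color (k N : ℕ) : IsOpen {c : ℕ → ℕ | ∃ x ≥ N, c x = k} := by
  have h : {c : ℕ → ℕ | ∃ x ≥ N, c x = k} = ⋃ x ≥ N, (fun c : ℕ → ℕ => c x) ⁻¹' {k} := by
    ext c
    simp
  rw [h]
  exact isOpen_biUnion fun x _ => (isOpen_discrete _).preimage (continuous_apply x)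

theorem dense_exists_color (k N : ℕ) : Dense {c : ℕ → ℕ | ∃ x ≥ N, c x = k} := by
  refine dense_of_finset fun c₀ F => ?_
  obtain ⟨x, hx⟩ := Infinite.exists_notMem_finset (F ∪ Finset.range N)
  simp only [Finset.mem_union, Finset.mem_range, not_or, not_lt] at hx
  refine ⟨Function.update c₀ x k, ⟨x, hx.2, by simp⟩, fun i hi => ?_⟩
  exact Function.update_of_ne (by rintro rfl; exact hx.1 hi) _ _

/-- Given `e`, a colouring `c` generic with respect to computable reductions from `c` to joins of
functions of `e` with `c`, and from `e` to `c`. -/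
theorem exists_generic_color (e a₁ b₁ a₂ b₂ : ℕ → ℕ) (hb₁ : b₁.Injective) (hb₂ : b₂.Injective) :
    ∃ c : ℕ → ℕ, (∀ k N, ∃ x ≥ N, c x = k) ∧
      (∀ g, Computable g → (∀ x y, c x = c y ↔ joinColor a₁ b₁ c (g x) = joinColor a₁ b₁ c (g y)) →
        {x | g x ≠ 2 * x + 1}.Finite) ∧
      (∀ g, Computable g → (∀ x y, c x = c y ↔ joinColor a₂ b₂ c (g x) = joinColor a₂ b₂ c (g y)) →
        {x | g x ≠ 2 * x + 1}.Finite) ∧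
      (∀ f, Computable f → (∀ x y, e x = e y ↔ c (f x) = c (f y)) → (Set.range f).Finite) := by
  have hcolor : ∀ᶠ c in residual (ℕ → ℕ), ∀ k N, ∃ x ≥ N, c x = k := by
    simp only [eventually_countable_forall]
    exact fun k N => residual_of_dense_open (isOpen_exists_color k N) (dense_exists_color k N)
  have hjoin : ∀ a b : ℕ → ℕ, b.Injective → ∀ᶠ c in residual (ℕ → ℕ), ∀ g ∈ {g | Computable g},
      (∀ x y, c x = c y ↔ joinColor a b c (g x) = joinColor a b c (g y)) →
        {x | g x ≠ 2 * x + 1}.Finite := by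
    intro a b hb
    rw [eventually_countable_ball countable_computable]
    intro g _
    by_cases hfin : {x | g x ≠ 2 * x + 1}.Finite
    · exact Filter.Eventually.of_forall fun _ _ => hfin
    · exact Filter.mem_of_superset (residual_of_dense_open
        (isOpen_not_reduction (u := fun c => c) (v := joinColor a b) continuous_apply
          (continuous_joinColor a b) g) (dense_not_reduction_join hb hfin))
        fun c hc h => absurd h hc
  have hred : ∀ᶠ c in residual (ℕ → ℕ), ∀ f ∈ {f | Computable f},
      (∀ x y, e x = e y ↔ c (f x) = c (f y)) → (Set.range f).Finite := by
    rw [eventually_countable_ball countable_computable]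
    intro f _
    by_cases hfin : (Set.range f).Finite
    · exact Filter.Eventually.of_forall fun _ _ => hfin
    · exact Filter.mem_of_superset (residual_of_dense_open
        (isOpen_not_reduction (u := fun _ => e) (v := fun c => c) (fun _ => continuous_const)
          continuous_apply f) (dense_not_reduction hfin))
        fun c hc h => absurd h hc
  obtain ⟨c, h₀, h₁, h₂, h₃⟩ := (dense_of_mem_residual
    (hcolor.and ((hjoin a₁ b₁ hb₁).and ((hjoin a₂ b₂ hb₂).and hred)))).nonempty
  exact ⟨c, h₀, h₁, h₂, h₃⟩

end Generic

theorem exists_equivC_idN_of_lub {E : ℕ → ℕ → Prop} (hE : Equivalence E)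
    (h : ∀ S : ℕ → ℕ → Prop, Equivalence S →
      ∃ T : ℕ → ℕ → Prop, Equivalence T ∧ IsLub' E S T) :
    ∃ n : ℕ, 1 ≤ n ∧ EquivC E (IdN n) := by
  obtain ⟨e, he⟩ := hE.exists_color
  have hb₂ : (fun k => 2 * k + 1 : ℕ → ℕ).Injective := fun x y hxy => by
    simp only at hxy
    omega
  obtain ⟨c, hc, h₁, h₂, h₃⟩ := exists_generic_color e e id (fun x => 2 * e x)
    (fun k => 2 * k + 1) Function.injective_id hb₂
  obtain ⟨T, hT, ⟨α, hα, hαr⟩, ⟨σ, hσ, hσr⟩, hlub⟩ := h _ (equivalence_color c)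
  have hEven : Computable fun x : ℕ => 2 * x :=
    Primrec.nat_mul.to_comp.comp (Computable.const 2) Computable.id
  have hOdd : Computable fun x : ℕ => 2 * x + 1 := Computable.succ.comp hEven
  have hjoin : ∀ a b : ℕ → ℕ, b.Injective → (∀ x y, e x = e y ↔ a x = a y) →
      CompRed T fun x y => joinColor a b c x = joinColor a b c y := by
    intro a b hb ha
    refine hlub _ (equivalence_color _) ⟨_, hEven, fun x y => ?_⟩ ⟨_, hOdd, fun x y => ?_⟩
    · beta_reduce
      rw [joinColor_even, joinColor_even, he, ha]
    · beta_reduce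
      rw [joinColor_odd, joinColor_odd, hb.eq_iff]
  obtain ⟨τ₁, hτ₁, hτ₁r⟩ := hjoin e id Function.injective_id fun _ _ => Iff.rfl
  obtain ⟨τ₂, hτ₂, hτ₂r⟩ := hjoin (fun x => 2 * e x) _ hb₂ fun x y => by omega
  have hfin := (h₁ _ (hτ₁.comp hσ) fun x y => (hσr x y).trans (hτ₁r _ _)).union
    (h₂ _ (hτ₂.comp hσ) fun x y => (hσr x y).trans (hτ₂r _ _))
  obtain ⟨N, hN⟩ := hfin.bddAbove
  have hodd : ∀ t, τ₂ t % 2 = 1 := by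
    intro t
    obtain ⟨x, hxN, hx⟩ := hc (joinColor e id c (τ₁ t)) (N + 1)
    have hmem : ¬ (τ₁ (σ x) ≠ 2 * x + 1 ∨ τ₂ (σ x) ≠ 2 * x + 1) := fun hmem => by
      have := hN hmem
      omega
    push Not at hmem
    have hst : T (σ x) t := by
      rw [hτ₁r, hmem.1]
      beta_reduce
      rw [joinColor_odd]
      exact hx
    rw [hτ₂r, hmem.2] at hst
    rw [joinColor_odd] at hst
    by_contra heven
    have h0 : τ₂ t % 2 = 0 := by omega
    simp only [joinColor, h0, if_true] at hst
    omega
  have hf : Computable fun x => τ₂ (α x) / 2 :=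
    Primrec.nat_div.to_comp.comp (hτ₂.comp hα) (Computable.const 2)
  have hfr : ∀ x y, E x y ↔ c (τ₂ (α x) / 2) = c (τ₂ (α y) / 2) := by
    intro x y
    rw [hαr, hτ₂r]
    simp [joinColor, hodd]
  exact exists_equivC_idN hE hf (h₃ _ hf fun x y => (he x y).symm.trans (hfr x y)) hfr

/-- `T` together with one new class `{0}`. -/
def AddClass (T : ℕ → ℕ → Prop) : ℕ → ℕ → Prop
  | 0, 0 => True
  | x + 1, y + 1 => T x y
  | _, _ => False

theorem AddClass.equivalence {T : ℕ → ℕ → Prop} (hT : Equivalence T) :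
    Equivalence (AddClass T) := by
  refine ⟨fun x => ?_, fun {x y} h => ?_, fun {x y z} h h' => ?_⟩
  · cases x
    · trivial
    · exact hT.refl _
  · cases x <;> cases y <;> first | exact h | exact hT.symm h
  · cases x <;> cases y <;> cases z <;>
      first | exact h | exact h' | exact h.elim | exact hT.trans h h'

theorem compRed_addClass (T : ℕ → ℕ → Prop) : CompRed T (AddClass T) :=
  ⟨_, Computable.succ, fun _ _ => Iff.rfl⟩

theorem AddClass.compRed {T U : ℕ → ℕ → Prop} (hU : Equivalence U) {f : ℕ → ℕ}
    (hf : Computable f) (hfr : ∀ x y, T x y ↔ U (f x) (f y)) {v : ℕ} (hv : ∀ x, ¬ U v (f x)) :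
    CompRed (AddClass T) U := by
  refine ⟨fun x => Nat.casesOn (motive := fun _ => ℕ) x v f,
    Computable.nat_casesOn Computable.id (Computable.const v) (hf.comp Computable.snd).to₂,
    fun x y => ?_⟩
  cases x <;> cases y
  · exact iff_of_true trivial (hU.refl _)
  · exact iff_of_false id (hv _)
  · exact iff_of_false id fun h => hv _ (hU.symm h)
  · exact hfr _ _

/-- A relation above `S` with at least `j ≤ n` classes and below every common upper bound of `S` and
`IdN n`, built by adding classes to `S` one at a time. -/
theorem exists_extension {S : ℕ → ℕ → Prop} (hS : Equivalence S) {n : ℕ} (j : ℕ) (hj : j ≤ n) :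
    ∃ T : ℕ → ℕ → Prop, Equivalence T ∧ CompRed S T ∧
      (∃ r : ℕ → ℕ, ∀ a < j, ∀ b < j, T (r a) (r b) → a = b) ∧
      ∀ U : ℕ → ℕ → Prop, Equivalence U → CompRed (IdN n) U → CompRed S U → CompRed T U := by
  induction j with
  | zero =>
    exact ⟨S, hS, ⟨id, Computable.id, fun _ _ => Iff.rfl⟩, ⟨id, by simp⟩, fun _ _ _ h => h⟩
  | succ j ih =>
    obtain ⟨T, hT, hST, ⟨r, hr⟩, hlub⟩ := ih (by omega)
    by_cases hex : ∃ r : ℕ → ℕ, ∀ a < n, ∀ b < n, T (r a) (r b) → a = b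
    · obtain ⟨s, hs⟩ := hex
      exact ⟨T, hT, hST, ⟨s, fun a ha b hb => hs a (by omega) b (by omega)⟩, hlub⟩
    refine ⟨AddClass T, AddClass.equivalence hT, hST.trans (compRed_addClass T),
      ⟨fun a => Nat.casesOn a 0 fun a => r a + 1, fun a ha b hb h => ?_⟩, fun U hU hnU hSU => ?_⟩
    · cases a <;> cases b
      · rfl
      · exact h.elim
      · exact h.elim
      · exact congrArg _ (hr _ (by omega) _ (by omega) h)
    · obtain ⟨f, hf, hfr⟩ := hlub U hU hnU hSU
      obtain ⟨g, _, hgr⟩ := hnU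
      by_cases hv : ∃ a, ∀ x, ¬ U (g a) (f x)
      · obtain ⟨a, ha⟩ := hv
        exact AddClass.compRed hU hf hfr ha
      · push Not at hv
        choose s hs using hv
        refine absurd ⟨s, fun a ha b hb h => ?_⟩ hex
        have h' := (hgr a b).2 (hU.trans (hs a) (hU.trans ((hfr _ _).1 h) (hU.symm (hs b))))
        simpa [IdN, Nat.mod_eq_of_lt, ha, hb] using h'

theorem stmt_11 (E : ℕ → ℕ → Prop) (hE : Equivalence E) :
    (∀ S : ℕ → ℕ → Prop, Equivalence S →
      ∃ T : ℕ → ℕ → Prop, Equivalence T ∧ IsLub' E S T) ↔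
    ∃ n : ℕ, 1 ≤ n ∧ EquivC E (IdN n) := by
  refine ⟨exists_equivC_idN_of_lub hE, ?_⟩
  rintro ⟨n, hn, hEn, hnE⟩ S hS
  obtain ⟨T, hT, hST, ⟨r, hr⟩, hlub⟩ := exists_extension hS n le_rfl
  exact ⟨T, hT, hEn.trans (compRed_idN hT hn r hr), hST,
    fun U hU hEU hSU => hlub U hU (hnE.trans hEU) hSU⟩
end
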